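/- arXiv:2509.23015 — 3 statements merged into one kernel-verified Lean document; each statement's English description precedes it below -/
import Mathlib

section
/- Let π : X → Y be a continuous surjection between compact metrizable spaces. Then the push-forward map M(π) : M(X) → M(Y) is almost one-to-one if and only if π is almost one-to-one. -/
open MeasureTheory Set

/-- A map `π` is irreducible if every closed subset `A ⊆ X` with `π(A) = Y` satisfies `A = X`. -/
def IsIrreducibleMap {X Y : Type*} [TopologicalSpace X] (π : X → Y) : Prop :=
  ∀ A : Set X, IsClosed A → π '' A = Set.univ → A = Set.univ

/-- `x` is an injectivity point of `π` if `π⁻¹(π(x)) = {x}`. -/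
def IsInjectivityPoint {X Y : Type*} (π : X → Y) (x : X) : Prop :=
  π ⁻¹' {π x} = {x}

/-- `π` is almost one-to-one if its set of injectivity points is dense. -/
def IsAlmostOneToOne {X Y : Type*} [TopologicalSpace X] (π : X → Y) : Prop :=
  Dense {x : X | IsInjectivityPoint π x}

/-- `π` is semi-open if the image of every nonempty open set has nonempty interior. -/
def IsSemiOpenMap {X Y : Type*} [TopologicalSpace X] [TopologicalSpace Y] (π : X → Y) : Prop :=
  ∀ U : Set X, IsOpen U → U.Nonempty → (interior (π '' U)).Nonempty

/-- The push-forward map `M(π) : M(X) → M(Y)` on spaces of Borel probability measures. -/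
noncomputable def pushforwardMap {X Y : Type*} [TopologicalSpace X] [TopologicalSpace Y]
    [MeasurableSpace X] [BorelSpace X] [MeasurableSpace Y] [BorelSpace Y]
    {π : X → Y} (hc : Continuous π) :
    ProbabilityMeasure X → ProbabilityMeasure Y :=
  fun μ => μ.map hc.measurable.aemeasurable

open Filter Topology TopologicalSpace

/-- Measures with finite support in a given dense set are weak* dense; more precisely, every
probability measure is a weak* limit of its images under simple functions valued in that set. -/
theorem mem_closure_map_simpleFunc {X : Type*} [TopologicalSpace X] [MetrizableSpace X]
    [SeparableSpace X] [MeasurableSpace X] [BorelSpace X] {D : Set X} (hD : Dense D)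
    (μ : ProbabilityMeasure X) :
    μ ∈ closure {ν : ProbabilityMeasure X | ∃ f : SimpleFunc X X,
      (∀ x, f x ∈ D) ∧ μ.map f.measurable.aemeasurable = ν} := by
  let := metrizableSpaceMetric X
  have : SecondCountableTopology X := UniformSpace.secondCountable_of_separable X
  have : Nonempty X := μ.nonempty
  obtain ⟨y, hy⟩ := hD.nonempty
  let f : ℕ → SimpleFunc X X := SimpleFunc.approxOn id measurable_id D y hy
  refine mem_closure_of_tendsto (b := atTop)
    (f := fun n => μ.map (f n).measurable.aemeasurable) ?_
    (.of_forall fun n => ⟨f n, SimpleFunc.approxOn_mem measurable_id hy n, rfl⟩)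
  rw [ProbabilityMeasure.tendsto_iff_forall_integral_tendsto]
  intro g
  simp only [ProbabilityMeasure.toMeasure_map]
  have hmap (n : ℕ) : ∫ x, g x ∂((μ : Measure X).map (f n)) = ∫ x, g (f n x) ∂(μ : Measure X) :=
    integral_map (f n).measurable.aemeasurable g.continuous.aestronglyMeasurable
  simp only [hmap]
  refine tendsto_integral_of_dominated_convergence (fun _ => ‖g‖)
    (fun n => (g.continuous.measurable.comp (f n).measurable).aestronglyMeasurable)
    (integrable_const _) (fun n => .of_forall fun x => g.norm_coe_le_norm _)
    (.of_forall fun x => (g.continuous.tendsto x).comp ?_)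
  exact SimpleFunc.tendsto_approxOn measurable_id hy (by simp [hD.closure_eq])

theorem continuous_pushforwardMap {X Y : Type*} [TopologicalSpace X] [TopologicalSpace Y]
    [MeasurableSpace X] [BorelSpace X] [MeasurableSpace Y] [BorelSpace Y]
    {π : X → Y} (hc : Continuous π) : Continuous (pushforwardMap hc) :=
  ProbabilityMeasure.continuous_map hc

theorem surjective_pushforwardMap {X Y : Type*} [TopologicalSpace X] [CompactSpace X] [T2Space X]
    [TopologicalSpace Y] [CompactSpace Y] [MetrizableSpace Y]
    [MeasurableSpace X] [BorelSpace X] [MeasurableSpace Y] [BorelSpace Y]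
    {π : X → Y} (hc : Continuous π) (hs : Function.Surjective π) :
    Function.Surjective (pushforwardMap hc) := by
  intro ν
  let := metrizableSpaceMetric Y
  have hclosed : IsClosed (range (pushforwardMap hc)) :=
    (isCompact_range (continuous_pushforwardMap hc)).isClosed
  refine hclosed.closure_subset_iff.2 ?_ (mem_closure_map_simpleFunc dense_univ ν)
  rintro _ ⟨f, -, rfl⟩
  let h : SimpleFunc Y X := f.map (Function.surjInv hs)
  refine ⟨ν.map h.measurable.aemeasurable, Subtype.ext ?_⟩
  change ((ν : Measure Y).map h).map π = (ν : Measure Y).map f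
  rw [Measure.map_map hc.measurable h.measurable]
  congr 1
  ext y
  exact Function.surjInv_eq hs (f y)

/-- A measure carried by finitely many injectivity points of `π` is an injectivity point of the
push-forward map. -/
theorem isInjectivityPoint_pushforwardMap_of_finite {X Y : Type*} [TopologicalSpace X] [T1Space X]
    [TopologicalSpace Y] [T1Space Y] [MeasurableSpace X] [BorelSpace X] [MeasurableSpace Y]
    [BorelSpace Y] {π : X → Y} (hc : Continuous π) {F : Set X} (hF : F.Finite)
    (hinj : ∀ x ∈ F, IsInjectivityPoint π x) {μ : ProbabilityMeasure X}
    (hμ : (μ : Measure X) F = 1) : IsInjectivityPoint (pushforwardMap hc) μ := by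
  refine Subset.antisymm (fun ν hν => ?_) (by simp)
  have hν : (ν : Measure X).map π = (μ : Measure X).map π := congrArg Subtype.val hν
  have key (A : Set X) : (ν : Measure X) (A ∩ F) = (μ : Measure X) (A ∩ F) := by
    have hpre : π ⁻¹' (π '' (A ∩ F)) = A ∩ F := by
      refine Subset.antisymm ?_ (subset_preimage_image _ _)
      rintro x ⟨z, hz, hzx⟩
      have hx : x ∈ π ⁻¹' {π z} := hzx.symm
      rw [hinj z hz.2, mem_singleton_iff] at hx
      exact hx ▸ hz
    have hm : MeasurableSet (π '' (A ∩ F)) :=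
      ((hF.subset inter_subset_right).image π).measurableSet
    rw [← hpre, ← Measure.map_apply hc.measurable hm, ← Measure.map_apply hc.measurable hm, hν]
  have hνF : (ν : Measure X) F = 1 := by simpa [hμ] using key univ
  have hμ0 : (μ : Measure X) Fᶜ = 0 := (prob_compl_eq_zero_iff hF.measurableSet).2 hμ
  have hν0 : (ν : Measure X) Fᶜ = 0 := (prob_compl_eq_zero_iff hF.measurableSet).2 hνF
  refine Subtype.ext (Measure.ext fun A _ => ?_)
  change (ν : Measure X) A = (μ : Measure X) A
  rw [← measure_inter_conull hν0, ← measure_inter_conull hμ0, key]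

theorem IsAlmostOneToOne.pushforwardMap {X Y : Type*} [TopologicalSpace X] [MetrizableSpace X]
    [SeparableSpace X] [TopologicalSpace Y] [T1Space Y] [MeasurableSpace X] [BorelSpace X]
    [MeasurableSpace Y] [BorelSpace Y] {π : X → Y} (hc : Continuous π) (h : IsAlmostOneToOne π) :
    IsAlmostOneToOne (pushforwardMap hc) := by
  intro μ
  refine closure_mono ?_ (mem_closure_map_simpleFunc h μ)
  rintro _ ⟨f, hf, rfl⟩
  refine isInjectivityPoint_pushforwardMap_of_finite hc f.finite_range
    (forall_mem_range.2 hf) ?_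
  rw [ProbabilityMeasure.map_apply' _ _ f.finite_range.measurableSet]
  simp

/-- If the push-forward map is almost one-to-one, then `π` is irreducible. -/
theorem isIrreducibleMap_of_isAlmostOneToOne_pushforwardMap {X Y : Type*} [TopologicalSpace X]
    [CompactSpace X] [MetrizableSpace X] [TopologicalSpace Y] [CompactSpace Y]
    [MetrizableSpace Y] [MeasurableSpace X] [BorelSpace X] [MeasurableSpace Y] [BorelSpace Y]
    {π : X → Y} (hc : Continuous π) (h : IsAlmostOneToOne (pushforwardMap hc)) :
    IsIrreducibleMap π := by
  intro A hA hAY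
  let := metrizableSpaceMetric X
  by_contra hne
  obtain ⟨x, hx⟩ := (ne_univ_iff_exists_notMem A).1 hne
  have hnhds : {μ : ProbabilityMeasure X | 0 < (μ : Measure X) Aᶜ} ∈ 𝓝 (diracProba x) := by
    filter_upwards [(diracProba x).toMeasure_add_pos_gt_mem_nhds hA.isOpen_compl one_pos] with μ hμ
    rw [pos_iff_ne_zero]
    intro h0
    simp [diracProba_toMeasure_apply' x hA.measurableSet.compl, hx, h0] at hμ
  obtain ⟨μ, hμpos, hμ⟩ := mem_closure_iff_nhds.1 (h (diracProba x)) _ hnhds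
  have : CompactSpace A := isCompact_iff_compactSpace.1 hA.isCompact
  have hcA : Continuous fun a : A => π a := hc.comp continuous_subtype_val
  have hsA : Function.Surjective fun a : A => π a := fun y => by
    obtain ⟨a, ha, rfl⟩ := hAY.symm ▸ mem_univ y
    exact ⟨⟨a, ha⟩, rfl⟩
  obtain ⟨ξ, hξ⟩ := surjective_pushforwardMap hcA hsA (pushforwardMap hc μ)
  have hξμ : pushforwardMap continuous_subtype_val ξ ∈
      pushforwardMap hc ⁻¹' {pushforwardMap hc μ} := by
    rw [mem_preimage, mem_singleton_iff, ← hξ]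
    exact Subtype.ext (Measure.map_map hc.measurable measurable_subtype_coe)
  rw [show pushforwardMap hc ⁻¹' {pushforwardMap hc μ} = {μ} from hμ, mem_singleton_iff] at hξμ
  refine (show 0 < (μ : Measure X) Aᶜ from hμpos).ne' ?_
  rw [← hξμ]
  change (ξ : Measure A).map Subtype.val Aᶜ = 0
  rw [Measure.map_apply measurable_subtype_coe hA.measurableSet.compl]
  simp

/-- An irreducible closed surjection from a metrizable Baire space is almost one-to-one. -/
theorem IsIrreducibleMap.isAlmostOneToOne {X Y : Type*} [TopologicalSpace X] [MetrizableSpace X]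
    [BaireSpace X] [TopologicalSpace Y] {π : X → Y} (h : IsIrreducibleMap π) (hc : Continuous π)
    (hcl : IsClosedMap π) (hs : Function.Surjective π) : IsAlmostOneToOne π := by
  let := metrizableSpaceMetric X
  -- `S U` is the union of the fibres of `π` contained in `U`.
  let S (U : Set X) : Set X := π ⁻¹' (π '' Uᶜ)ᶜ
  have hSU (U : Set X) : S U ⊆ U := fun x hx => by
    by_contra hxU
    exact hx ⟨x, hxU, rfl⟩
  have hSo {U : Set X} (hU : IsOpen U) : IsOpen (S U) :=
    (hcl _ hU.isClosed_compl).isOpen_compl.preimage hc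
  have hSne {U : Set X} (hU : IsOpen U) (hne : U.Nonempty) : (S U).Nonempty := by
    have himage : π '' Uᶜ ≠ univ := fun himage =>
      hne.ne_empty (compl_univ_iff.1 (h _ hU.isClosed_compl himage))
    obtain ⟨y, hy⟩ := (ne_univ_iff_exists_notMem _).1 himage
    obtain ⟨x, rfl⟩ := hs y
    exact ⟨x, hy⟩
  let D (n : ℕ) : Set X := ⋃ z : X, S (Metric.ball z (1 / ((n : ℝ) + 1)))
  have hDo (n : ℕ) : IsOpen (D n) := isOpen_iUnion fun z => hSo Metric.isOpen_ball
  have hDd (n : ℕ) : Dense (D n) := by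
    refine dense_iff_inter_open.2 fun W hW hWne => ?_
    obtain ⟨w, hw⟩ := hWne
    obtain ⟨x, hx⟩ := hSne (hW.inter (Metric.isOpen_ball (x := w) (ε := 1 / ((n : ℝ) + 1))))
      ⟨w, hw, Metric.mem_ball_self Nat.one_div_pos_of_nat⟩
    refine ⟨x, (hSU _ hx).1, mem_iUnion.2 ⟨w, fun hx' => hx ?_⟩⟩
    exact image_mono (compl_subset_compl.2 inter_subset_right) hx'
  refine (dense_iInter_of_isOpen_nat hDo hDd).mono fun x hx => ?_
  refine Subset.antisymm (fun x' hx' => ?_) (by simp)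
  have hfib {U : Set X} (hxU : x ∈ S U) : x' ∈ U := by
    by_contra hx'U
    exact hxU ⟨x', hx'U, hx'⟩
  refine dist_le_zero.1 (le_of_forall_pos_lt_add fun ε hε => ?_)
  obtain ⟨n, hn⟩ := exists_nat_one_div_lt (half_pos hε)
  obtain ⟨z, hz⟩ := mem_iUnion.1 (mem_iInter.1 hx n)
  have hxz := Metric.mem_ball.1 (hSU _ hz)
  have hxz' := Metric.mem_ball.1 (hfib hz)
  linarith [dist_triangle_right x' x z]

theorem stmt_3 {X Y : Type*} [TopologicalSpace X] [CompactSpace X] [T2Space X]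
    [TopologicalSpace Y] [CompactSpace Y] [T2Space Y] [MeasurableSpace X] [BorelSpace X] [MeasurableSpace Y] [BorelSpace Y]
    [TopologicalSpace.MetrizableSpace X] [TopologicalSpace.MetrizableSpace Y]
    (π : X → Y) (hc : Continuous π) (hs : Function.Surjective π) :
    IsAlmostOneToOne (pushforwardMap hc) ↔ IsAlmostOneToOne π := by
  refine ⟨fun h => ?_, fun h => h.pushforwardMap hc⟩
  exact (isIrreducibleMap_of_isAlmostOneToOne_pushforwardMap hc h).isAlmostOneToOne hc
    hc.isClosedMap hs
end

section
/- Let π : X → Y be a continuous surjection between compact metrizable spaces. Then the induced map H(π) : H(X) → H(Y), A ↦ π(A), between the hyperspaces is almost one-to-one if and only if π is almost one-to-one. -/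
open MeasureTheory Set

/-- The hyperspace of all nonempty closed subsets of `X`. -/
def Hyperspace (X : Type*) [TopologicalSpace X] : Type _ :=
  {A : Set X // IsClosed A ∧ A.Nonempty}

/-- The Vietoris topology on the hyperspace, generated by the subbasic sets
`{A | A ⊆ U}` and `{A | A ∩ U ≠ ∅}` for `U` open. -/
instance Hyperspace.instTopologicalSpace (X : Type*) [TopologicalSpace X] :
    TopologicalSpace (Hyperspace X) :=
  TopologicalSpace.generateFrom
    ({S | ∃ U : Set X, IsOpen U ∧ S = {A : Hyperspace X | A.1 ⊆ U}} ∪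
      {S | ∃ U : Set X, IsOpen U ∧ S = {A : Hyperspace X | (A.1 ∩ U).Nonempty}})

/-- The induced map `H(π) : H(X) → H(Y)`, sending `A` to `π(A)`. -/
def hyperMap {X Y : Type*} [TopologicalSpace X] [TopologicalSpace Y]
    [CompactSpace X] [T2Space Y] {π : X → Y} (hc : Continuous π) :
    Hyperspace X → Hyperspace Y :=
  fun A => ⟨π '' A.1, (A.2.1.isCompact.image hc).isClosed, A.2.2.image π⟩

/-- Every Vietoris neighbourhood of `A` contains a basic one, given by an open set containing `A`
and finitely many open sets meeting `A`. -/
lemma Hyperspace.exists_basic_subset {X : Type*} [TopologicalSpace X] {W : Set (Hyperspace X)}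
    (hW : IsOpen W) {A : Hyperspace X} (hA : A ∈ W) :
    ∃ U : Set X, IsOpen U ∧ A.1 ⊆ U ∧ ∃ 𝒱 : Set (Set X), 𝒱.Finite ∧
      (∀ V ∈ 𝒱, IsOpen V ∧ (A.1 ∩ V).Nonempty) ∧
      ∀ B : Hyperspace X, B.1 ⊆ U → (∀ V ∈ 𝒱, (B.1 ∩ V).Nonempty) → B ∈ W := by
  induction hW with
  | basic S hS =>
    rcases hS with ⟨U, hU, rfl⟩ | ⟨V, hV, rfl⟩
    · exact ⟨U, hU, hA, ∅, finite_empty, by simp, fun B hB _ => hB⟩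
    · exact ⟨univ, isOpen_univ, subset_univ _, {V}, finite_singleton V,
        by rintro _ rfl; exact ⟨hV, hA⟩, fun B _ hB => hB V rfl⟩
  | univ =>
    exact ⟨univ, isOpen_univ, subset_univ _, ∅, finite_empty, by simp, fun B _ _ => mem_univ B⟩
  | inter S T _ _ ihS ihT =>
    obtain ⟨U, hU, hAU, 𝒱, hf, h𝒱, h⟩ := ihS hA.1
    obtain ⟨U', hU', hAU', 𝒱', hf', h𝒱', h'⟩ := ihT hA.2
    refine ⟨U ∩ U', hU.inter hU', subset_inter hAU hAU', 𝒱 ∪ 𝒱', hf.union hf', ?_, ?_⟩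
    · rintro V (hV | hV)
      exacts [h𝒱 V hV, h𝒱' V hV]
    · exact fun B hB hV => ⟨h B (hB.trans inter_subset_left) fun V hm => hV V (Or.inl hm),
        h' B (hB.trans inter_subset_right) fun V hm => hV V (Or.inr hm)⟩
  | sUnion 𝒮 _ ih =>
    obtain ⟨S, hS, hAS⟩ := hA
    obtain ⟨U, hU, hAU, 𝒱, hf, h𝒱, h⟩ := ih S hS hAS
    exact ⟨U, hU, hAU, 𝒱, hf, h𝒱, fun B hB hV => ⟨S, hS, h B hB hV⟩⟩

/-- The nonempty finite subsets of a dense set are dense in the hyperspace. -/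
lemma Hyperspace.dense_finite_subsets {X : Type*} [TopologicalSpace X] [T1Space X] {D : Set X}
    (hD : Dense D) : Dense {A : Hyperspace X | A.1.Finite ∧ A.1 ⊆ D} := by
  rw [dense_iff_inter_open]
  rintro W hW ⟨A, hA⟩
  obtain ⟨U, hU, hAU, 𝒱, hf, h𝒱, h⟩ := Hyperspace.exists_basic_subset hW hA
  have hmeet : ∀ V ∈ insert univ 𝒱, ∃ x, x ∈ U ∩ V ∧ x ∈ D := by
    intro V hV
    have hV' : IsOpen V ∧ (A.1 ∩ V).Nonempty := by
      rcases hV with rfl | hV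
      · exact ⟨isOpen_univ, by simpa using A.2.2⟩
      · exact h𝒱 V hV
    exact hD.inter_open_nonempty _ (hU.inter hV'.1) (hV'.2.mono (inter_subset_inter_left V hAU))
  have : Nonempty X := A.2.2.to_subtype.map Subtype.val
  choose! p hp hpD using hmeet
  have hfin : (p '' insert univ 𝒱).Finite := (hf.insert univ).image p
  refine ⟨⟨p '' insert univ 𝒱, hfin.isClosed, (insert_nonempty _ _).image p⟩, ?_, hfin, ?_⟩
  · refine h _ ?_ fun V hV =>
      ⟨p V, mem_image_of_mem p (mem_insert_of_mem _ hV), (hp V (mem_insert_of_mem _ hV)).2⟩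
    rintro _ ⟨V, hV, rfl⟩
    exact (hp V hV).1
  · rintro _ ⟨V, hV, rfl⟩
    exact hpD V hV

section hyperMap

variable {X Y : Type*} [TopologicalSpace X] [TopologicalSpace Y] [CompactSpace X] [T2Space Y]
  {π : X → Y}

/-- A closed set of injectivity points of `π` is an injectivity point of the induced map. -/
lemma isInjectivityPoint_hyperMap (hc : Continuous π) {A : Hyperspace X}
    (hA : ∀ x ∈ A.1, IsInjectivityPoint π x) : IsInjectivityPoint (hyperMap hc) A := by
  refine Subset.antisymm (fun B hB => ?_) (by rintro _ rfl; rfl)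
  have himage : π '' B.1 = π '' A.1 := congrArg Subtype.val hB
  have key : ∀ {x z}, x ∈ A.1 → π z = π x → z = x := fun {x z} hx hz =>
    (hA x hx).subset (show z ∈ π ⁻¹' {π x} from hz)
  refine Subtype.ext (Subset.antisymm (fun z hz => ?_) fun x hx => ?_)
  · obtain ⟨x, hx, hxz⟩ := himage.subset (mem_image_of_mem π hz)
    rwa [key hx hxz.symm]
  · obtain ⟨z, hz, hzx⟩ := himage.superset (mem_image_of_mem π hx)
    rwa [← key hx hzx]

/-- An injectivity point of the induced map is saturated. -/
lemma IsInjectivityPoint.preimage_image_eq (hc : Continuous π) {A : Hyperspace X}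
    (hA : IsInjectivityPoint (hyperMap hc) A) : π ⁻¹' (π '' A.1) = A.1 := by
  let B : Hyperspace X := ⟨π ⁻¹' (π '' A.1), (hyperMap hc A).2.1.preimage hc,
    A.2.2.mono (subset_preimage_image π A.1)⟩
  have hB : B ∈ hyperMap hc ⁻¹' {hyperMap hc A} :=
    Subtype.ext (Subset.antisymm (image_preimage_subset π _)
      (image_mono (subset_preimage_image π A.1)))
  exact congrArg Subtype.val (hA.subset hB)

/-- If the induced map is almost one-to-one, every nonempty open set contains a fibre. -/
lemma IsAlmostOneToOne.exists_fiber_subset [T1Space X] (hc : Continuous π)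
    (h : IsAlmostOneToOne (hyperMap hc)) {U : Set X} (hU : IsOpen U) (hne : U.Nonempty) :
    ∃ x ∈ U, π ⁻¹' {π x} ⊆ U := by
  obtain ⟨u, hu⟩ := hne
  have hopen : IsOpen {A : Hyperspace X | A.1 ⊆ U} :=
    TopologicalSpace.isOpen_generateFrom_of_mem (Or.inl ⟨U, hU, rfl⟩)
  obtain ⟨A, hAU, hA⟩ := h.inter_open_nonempty _ hopen
    ⟨⟨{u}, isClosed_singleton, singleton_nonempty u⟩, singleton_subset_iff.2 hu⟩
  obtain ⟨x, hx⟩ := A.2.2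
  refine ⟨x, hAU hx, fun z hz => hAU ?_⟩
  rw [← hA.preimage_image_eq hc]
  exact ⟨x, hx, hz.symm⟩

/-- The set of points whose fibre lies in a given open set is open. -/
lemma isOpen_setOf_fiber_subset (hc : Continuous π) {U : Set X} (hU : IsOpen U) :
    IsOpen {x | π ⁻¹' {π x} ⊆ U} := by
  have heq : {x | π ⁻¹' {π x} ⊆ U} = π ⁻¹' (π '' Uᶜ)ᶜ := by
    ext x
    simp only [mem_ofPred_eq, subset_def, mem_preimage, mem_singleton_iff, mem_compl_iff, mem_image,
      not_exists, not_and]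
    exact forall_congr' fun z => by tauto
  rw [heq]
  exact (hU.isClosed_compl.isCompact.image hc).isClosed.isOpen_compl.preimage hc

/-- If every nonempty open set of a compact metrizable space contains a fibre of `π`, then `π` is
almost one-to-one. -/
lemma isAlmostOneToOne_of_exists_fiber_subset [TopologicalSpace.MetrizableSpace X]
    (hc : Continuous π)
    (h : ∀ U : Set X, IsOpen U → U.Nonempty → ∃ x ∈ U, π ⁻¹' {π x} ⊆ U) :
    IsAlmostOneToOne π := by
  let := TopologicalSpace.metrizableSpaceMetric X
  have hdense : Dense (⋂ n : ℕ, ⋃ c : X,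
      {x | π ⁻¹' {π x} ⊆ Metric.ball c (1 / ((n : ℝ) + 1))}) := by
    refine dense_iInter_of_isOpen
      (fun n => isOpen_iUnion fun c => isOpen_setOf_fiber_subset hc Metric.isOpen_ball) fun n => ?_
    rw [dense_iff_inter_open]
    rintro U hU ⟨u, hu⟩
    obtain ⟨x, hx, hfib⟩ := h _ (hU.inter Metric.isOpen_ball)
      ⟨u, hu, Metric.mem_ball_self (Nat.one_div_pos_of_nat (α := ℝ) (n := n))⟩
    exact ⟨x, hx.1, mem_iUnion.2 ⟨u, hfib.trans inter_subset_right⟩⟩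
  refine hdense.mono fun x hx => Subset.antisymm (fun z hz => ?_) (by rintro _ rfl; rfl)
  refine eq_of_forall_dist_le fun ε hε => ?_
  obtain ⟨n, hn⟩ := exists_nat_one_div_lt (half_pos hε)
  obtain ⟨c, hball⟩ := mem_iUnion.1 (mem_iInter.1 hx n)
  have hzc : dist z c < 1 / ((n : ℝ) + 1) := hball hz
  have hxc : dist x c < 1 / ((n : ℝ) + 1) := hball (show π x = π x from rfl)
  linarith [dist_triangle_right z x c]

end hyperMap

theorem stmt_4 {X Y : Type*} [TopologicalSpace X] [CompactSpace X] [T2Space X]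
    [TopologicalSpace Y] [CompactSpace Y] [T2Space Y]
    [TopologicalSpace.MetrizableSpace X] [TopologicalSpace.MetrizableSpace Y]
    (π : X → Y) (hc : Continuous π) (hs : Function.Surjective π) :
    IsAlmostOneToOne (hyperMap hc) ↔ IsAlmostOneToOne π :=
  ⟨fun h => isAlmostOneToOne_of_exists_fiber_subset hc fun _ => h.exists_fiber_subset hc,
    fun h => (Hyperspace.dense_finite_subsets h).mono fun _ hA =>
      isInjectivityPoint_hyperMap hc hA.2⟩
end

section
/- Let φ : X → Y and ψ : Y → Z be continuous surjections between compact Hausdorff spaces, with X metrizable, and let π := ψ ∘ φ. Then π is almost one-to-one if and only if both φ and ψ are almost one-to-one. -/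
open MeasureTheory Set

theorem IsInjectivityPoint.eq {X Y : Type*} {f : X → Y} {x x' : X}
    (hx : IsInjectivityPoint f x) (h : f x' = f x) : x' = x := by
  have : x' ∈ f ⁻¹' {f x} := h
  rw [hx] at this
  exact this

theorem isInjectivityPoint_of_forall {X Y : Type*} {f : X → Y} {x : X}
    (h : ∀ x', f x' = f x → x' = x) : IsInjectivityPoint f x :=
  Set.Subset.antisymm (fun x' hx' => h x' hx') (by rintro _ rfl; rfl)

theorem IsInjectivityPoint.of_comp {X Y Z : Type*} {φ : X → Y} {ψ : Y → Z} {x : X}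
    (hx : IsInjectivityPoint (ψ ∘ φ) x) : IsInjectivityPoint φ x :=
  isInjectivityPoint_of_forall fun _ h => hx.eq (congrArg ψ h)

theorem IsInjectivityPoint.map_of_comp {X Y Z : Type*} {φ : X → Y} {ψ : Y → Z}
    (hφ : Function.Surjective φ) {x : X}
    (hx : IsInjectivityPoint (ψ ∘ φ) x) : IsInjectivityPoint ψ (φ x) := by
  refine isInjectivityPoint_of_forall fun y h => ?_
  obtain ⟨x', rfl⟩ := hφ y
  exact congrArg φ (hx.eq h)

/-- If `φ` and `ψ` are almost one-to-one and `φ` is closed, then every nonempty open set contains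
an entire fibre of `ψ ∘ φ`. -/
theorem exists_fiber_comp_subset {X Y Z : Type*} [TopologicalSpace X] [TopologicalSpace Y]
    {φ : X → Y} {ψ : Y → Z} (hφc : IsClosedMap φ) (hφs : Function.Surjective φ)
    (hφ : IsAlmostOneToOne φ) (hψ : IsAlmostOneToOne ψ) {U : Set X} (hU : IsOpen U)
    (hne : U.Nonempty) : ∃ x ∈ U, (ψ ∘ φ) ⁻¹' {(ψ ∘ φ) x} ⊆ U := by
  obtain ⟨x, hxU, hx⟩ := hφ.inter_open_nonempty U hU hne
  have hV : IsOpen (Set.kernImage φ U) := isClosedMap_iff_kernImage.1 hφc hU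
  have hxV : φ x ∈ Set.kernImage φ U := by
    intro x' h
    rwa [IsInjectivityPoint.eq hx h]
  obtain ⟨y, hyV, hy⟩ := hψ.inter_open_nonempty _ hV ⟨_, hxV⟩
  obtain ⟨x', rfl⟩ := hφs y
  exact ⟨x', hyV rfl, fun z hz => hyV (IsInjectivityPoint.eq hy hz)⟩

/-- A closed continuous map on a Baire metric space is almost one-to-one as soon as every nonempty
open set contains an entire fibre. -/
theorem isAlmostOneToOne_of_exists_fiber_subset_s16 {X Z : Type*} [MetricSpace X] [BaireSpace X]
    [TopologicalSpace Z] {f : X → Z} (hf : Continuous f) (hfc : IsClosedMap f)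
    (h : ∀ U : Set X, IsOpen U → U.Nonempty → ∃ x ∈ U, f ⁻¹' {f x} ⊆ U) :
    IsAlmostOneToOne f := by
  let W : ℕ → Set X := fun n =>
    ⋃ c : X, f ⁻¹' Set.kernImage f (Metric.ball c (1 / ((n : ℝ) + 1)))
  have hWo : ∀ n, IsOpen (W n) := fun n => isOpen_iUnion fun c =>
    (isClosedMap_iff_kernImage.1 hfc Metric.isOpen_ball).preimage hf
  have hWd : ∀ n, Dense (W n) := by
    refine fun n => dense_iff_inter_open.2 fun U hU ⟨u, hu⟩ => ?_
    obtain ⟨x, hx, hsub⟩ := h (U ∩ Metric.ball u (1 / ((n : ℝ) + 1)))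
      (hU.inter Metric.isOpen_ball) ⟨u, hu, Metric.mem_ball_self (by positivity)⟩
    exact ⟨x, hx.1, Set.mem_iUnion.2 ⟨u, fun _ hz => (hsub hz).2⟩⟩
  refine (dense_iInter_of_isOpen_nat hWo hWd).mono fun x hx => ?_
  refine isInjectivityPoint_of_forall fun x' hx' => dist_le_zero.1 ?_
  refine le_of_forall_pos_le_add fun ε hε => ?_
  obtain ⟨n, hn⟩ := exists_nat_one_div_lt (half_pos hε)
  obtain ⟨c, hc⟩ := Set.mem_iUnion.1 (Set.mem_iInter.1 hx n)
  have h₁ : dist x' c < 1 / ((n : ℝ) + 1) := hc hx'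
  have h₂ : dist x c < 1 / ((n : ℝ) + 1) := hc rfl
  linarith [dist_triangle_right x' x c]

theorem stmt_16 {X Y Z : Type*} [TopologicalSpace X] [CompactSpace X] [T2Space X]
    [TopologicalSpace Y] [CompactSpace Y] [T2Space Y]
    [TopologicalSpace Z] [CompactSpace Z] [T2Space Z]
    (φ : X → Y) (ψ : Y → Z) (hφc : Continuous φ) (hφs : Function.Surjective φ)
    (hψc : Continuous ψ) (hψs : Function.Surjective ψ)
    [TopologicalSpace.MetrizableSpace X] :
    IsAlmostOneToOne (ψ ∘ φ) ↔ IsAlmostOneToOne φ ∧ IsAlmostOneToOne ψ := by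
  constructor
  · intro h
    refine ⟨h.mono fun x hx => hx.of_comp, ?_⟩
    refine (hφs.denseRange.dense_image hφc h).mono ?_
    rintro _ ⟨x, hx, rfl⟩
    exact IsInjectivityPoint.map_of_comp hφs hx
  · rintro ⟨hφ, hψ⟩
    let := TopologicalSpace.metrizableSpaceMetric X
    have hπ : Continuous (ψ ∘ φ) := hψc.comp hφc
    exact isAlmostOneToOne_of_exists_fiber_subset_s16 hπ hπ.isClosedMap fun U hU hne =>
      exists_fiber_comp_subset hφc.isClosedMap hφs hφ hψ hU hne
end
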